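/- arXiv:1101.3093 — 5 statements merged into one kernel-verified Lean document; each statement's English description precedes it below -/
import Mathlib

section
/- Let V be a real vector space of finite dimension n ≥ 2 and let H be a compact subgroup of GL(V). Then there exists an H-invariant Lorentzian symmetric bilinear form on V if and only if there exists a one-dimensional linear subspace L ⊆ V with h(L) = L for every h ∈ H. -/
open MeasureTheory

/-- A compact group of automorphisms of a finite-dimensional real vector space preserves an
inner product. -/
theorem exists_invariant_inner_product {V : Type*} [NormedAddCommGroup V]
    [NormedSpace ℝ V] [FiniteDimensional ℝ V]
    (H : Subgroup (V →L[ℝ] V)ˣ) (hH : IsCompact (H : Set (V →L[ℝ] V)ˣ)) :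
    ∃ b : V →ₗ[ℝ] V →ₗ[ℝ] ℝ, (∀ x y, b x y = b y x) ∧ (∀ x, x ≠ 0 → 0 < b x x) ∧
      ∀ h ∈ H, ∀ x y : V, b ((h : V →L[ℝ] V) x) ((h : V →L[ℝ] V) y) = b x y := by
  have : CompactSpace H := isCompact_iff_compactSpace.mp hH
  let _ : MeasurableSpace H := borel H
  have : BorelSpace H := ⟨rfl⟩
  let μ : Measure H := Measure.haar
  let T : H → V → EuclideanSpace ℝ (Fin (Module.finrank ℝ V)) :=
    fun h x => toEuclidean ((((h⁻¹ : H) : (V →L[ℝ] V)ˣ) : V →L[ℝ] V) x)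
  have hT : ∀ x, Continuous fun h => T h x := fun x => by
    have : Continuous fun h : H => (((h⁻¹ : H) : (V →L[ℝ] V)ˣ) : V →L[ℝ] V) :=
      Units.continuous_val.comp (continuous_subtype_val.comp continuous_inv)
    exact toEuclidean.continuous.comp (this.clm_apply continuous_const)
  have hc : ∀ x y, Continuous fun h => inner ℝ (T h x) (T h y) :=
    fun x y => (hT x).inner (hT y)
  have hi : ∀ x y, Integrable (fun h => inner ℝ (T h x) (T h y)) μ := fun x y =>
    (hc x y).integrable_of_hasCompactSupport (HasCompactSupport.of_compactSpace _)
  let b : V →ₗ[ℝ] V →ₗ[ℝ] ℝ := LinearMap.mk₂ ℝ (fun x y => ∫ h, inner ℝ (T h x) (T h y) ∂μ)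
    (fun x x' y => by
      rw [← integral_add (hi _ _) (hi _ _)]
      simp [T, inner_add_left])
    (fun c x y => by
      rw [smul_eq_mul, ← integral_const_mul]
      simp [T, real_inner_smul_left])
    (fun x y y' => by
      rw [← integral_add (hi _ _) (hi _ _)]
      simp [T, inner_add_right])
    (fun c x y => by
      rw [smul_eq_mul, ← integral_const_mul]
      simp [T, real_inner_smul_right])
  have hb : ∀ x y, b x y = ∫ h, inner ℝ (T h x) (T h y) ∂μ := fun _ _ => rfl
  refine ⟨b, fun x y => ?_, fun x hx => ?_, fun k hk x y => ?_⟩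
  · simp only [hb, real_inner_comm]
  · rw [hb]
    refine (hc x x).integral_pos_of_hasCompactSupport_nonneg_nonzero
      (HasCompactSupport.of_compactSpace _) (fun _ => real_inner_self_nonneg) (x := 1) ?_
    simpa [T] using hx
  · have key : ∀ (h : H) (z : V), T h ((k : V →L[ℝ] V) z) = T ((⟨k, hk⟩ : H)⁻¹ * h) z := by
      intro h z
      simp [T]
    simp only [hb, key]
    exact integral_mul_left_eq_self (μ := μ) (fun h => inner ℝ (T h x) (T h y)) (⟨k, hk⟩ : H)⁻¹

/-- For a positive definite form `b`, every form `g` has a smallest generalized eigenvalue: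
some `r` for which `g - r b` is positive semidefinite and degenerate. -/
theorem exists_isotropic_of_posDef {V : Type*} [NormedAddCommGroup V] [NormedSpace ℝ V]
    [FiniteDimensional ℝ V] [Nontrivial V] (g b : V →ₗ[ℝ] V →ₗ[ℝ] ℝ)
    (hb : ∀ x, x ≠ 0 → 0 < b x x) :
    ∃ r : ℝ, (∀ x, r * b x x ≤ g x x) ∧ ∃ x, x ≠ 0 ∧ g x x = r * b x x := by
  have : ProperSpace V := FiniteDimensional.proper ℝ V
  have hcont : ∀ f : V →ₗ[ℝ] V →ₗ[ℝ] ℝ, Continuous fun x => f x x := fun f => by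
    have h1 : Continuous fun x => LinearMap.toContinuousLinearMap (f x) :=
      ((LinearMap.toContinuousLinearMap (𝕜 := ℝ) (E := V) (F' := ℝ)).toLinearMap ∘ₗ
        f).continuous_of_finiteDimensional
    exact h1.clm_apply continuous_id
  have hne : ∀ x ∈ Metric.sphere (0 : V) 1, x ≠ 0 := fun x hx =>
    ne_zero_of_mem_unit_sphere (⟨x, hx⟩ : Metric.sphere (0 : V) 1)
  obtain ⟨v, hv, hmin⟩ := (isCompact_sphere (0 : V) 1).exists_isMinOn
    ((NormedSpace.sphere_nonempty (x := (0 : V)) (r := 1)).mpr zero_le_one)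
    (f := fun x => g x x / b x x)
    ((hcont g).continuousOn.div (hcont b).continuousOn fun x hx => (hb x (hne x hx)).ne')
  refine ⟨g v v / b v v, fun x => ?_, v, hne v hv, ?_⟩
  · by_cases hx : x = 0
    · simp [hx]
    have hn : ‖x‖ ≠ 0 := norm_ne_zero_iff.mpr hx
    have hs : ‖x‖⁻¹ • x ∈ Metric.sphere (0 : V) 1 := by
      simp [norm_smul, hn]
    have h := isMinOn_iff.mp hmin _ hs
    rw [← le_div_iff₀ (hb x hx)]
    refine h.trans (le_of_eq ?_)
    have := (hb x hx).ne'
    simp only [map_smul, LinearMap.smul_apply, smul_eq_mul]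
    field_simp
  · rw [div_mul_cancel₀ _ (hb v (hne v hv)).ne']

/-- An isotropic vector of a positive semidefinite symmetric form lies in its radical. -/
theorem apply_eq_zero_of_apply_self_eq_zero {V : Type*} [AddCommGroup V] [Module ℝ V]
    (q : V →ₗ[ℝ] V →ₗ[ℝ] ℝ) (hq : ∀ x y, q x y = q y x) (hpos : ∀ x, 0 ≤ q x x)
    {x : V} (hx : q x x = 0) (y : V) : q x y = 0 := by
  have h : ∀ s : ℝ, 0 ≤ 0 * (s * s) + 2 * q x y * s + q y y := fun s => by
    have := hpos (s • x + y)
    simp only [map_add, map_smul, LinearMap.add_apply, LinearMap.smul_apply, smul_eq_mul, hx,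
      hq y x] at this
    linarith
  have := discrim_le_zero h
  simp only [discrim] at this
  nlinarith [sq_nonneg (q x y)]

theorem map_eq_of_forall_map_le {V : Type*} [NormedAddCommGroup V] [NormedSpace ℝ V]
    (H : Subgroup (V →L[ℝ] V)ˣ) (L : Submodule ℝ V)
    (hL : ∀ h ∈ H, ∀ x ∈ L, (h : V →L[ℝ] V) x ∈ L) {h : (V →L[ℝ] V)ˣ} (hh : h ∈ H) :
    L.map ((h : V →L[ℝ] V) : V →ₗ[ℝ] V) = L := by
  apply le_antisymm
  · rintro _ ⟨x, hx, rfl⟩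
    exact hL h hh x hx
  · intro x hx
    refine ⟨_, hL h⁻¹ (H.inv_mem hh) x hx, ?_⟩
    change ((h : V →L[ℝ] V) * ((h⁻¹ : (V →L[ℝ] V)ˣ) : V →L[ℝ] V)) x = x
    simp


/-- A bilinear form `g` on a real vector space `V` is Lorentzian (of signature `(1, n-1)`)
if there exist `t ∈ V` and a subspace `W` with `V = ℝt ⊕ W`, `g t t < 0`, `g t w = 0` for all
`w ∈ W`, and the restriction of `g` to `W` positive definite. -/
def IsLorentzian {V : Type*} [AddCommGroup V] [Module ℝ V]
    (g : V →ₗ[ℝ] V →ₗ[ℝ] ℝ) : Prop :=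
  ∃ (t : V) (W : Submodule ℝ V),
    IsCompl (Submodule.span ℝ ({t} : Set V)) W ∧
    g t t < 0 ∧ (∀ w ∈ W, g t w = 0) ∧ (∀ w ∈ W, w ≠ 0 → 0 < g w w)

/-- A compact subgroup `H ⊆ GL(V)` of a real vector space of finite dimension `n ≥ 2`
admits an invariant Lorentzian symmetric bilinear form if and only if it preserves some
one-dimensional subspace `L ⊆ V`. -/
theorem stmt0 {n : ℕ} (hn : 2 ≤ n) {V : Type*} [NormedAddCommGroup V]
    [NormedSpace ℝ V] [FiniteDimensional ℝ V] (hdim : Module.finrank ℝ V = n)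
    (H : Subgroup (V →L[ℝ] V)ˣ) (hH : IsCompact (H : Set (V →L[ℝ] V)ˣ)) :
    (∃ g : V →ₗ[ℝ] V →ₗ[ℝ] ℝ, (∀ x y, g x y = g y x) ∧ IsLorentzian g ∧
        ∀ h ∈ H, ∀ x y : V, g ((h : V →L[ℝ] V) x) ((h : V →L[ℝ] V) y) = g x y) ↔
      ∃ L : Submodule ℝ V, Module.finrank ℝ ↥L = 1 ∧
        ∀ h ∈ H, L.map ((h : V →L[ℝ] V) : V →ₗ[ℝ] V) = L := by
  obtain ⟨b, hbs, hbp, hbi⟩ := exists_invariant_inner_product H hH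
  have : Nontrivial V := Module.nontrivial_of_finrank_pos (R := ℝ) (by omega)
  constructor
  · rintro ⟨g, hgs, ⟨t, W, hc, htt, -, hW⟩, hgi⟩
    obtain ⟨r, hr, v, hv0, hv⟩ := exists_isotropic_of_posDef g b hbp
    have ht0 : t ≠ 0 := by
      rintro rfl
      simp at htt
    have hr0 : r < 0 := by nlinarith [hr t, hbp t ht0]
    have hmem : ∀ x, x ∈ LinearMap.ker (g - r • b) ↔ ∀ y, g x y = r * b x y := fun x => by
      simp [LinearMap.ext_iff, sub_eq_zero]
    have hvL : v ∈ LinearMap.ker (g - r • b) := by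
      rw [LinearMap.mem_ker]
      ext y
      refine apply_eq_zero_of_apply_self_eq_zero (g - r • b) (fun x y => ?_) (fun x => ?_) ?_ y
      · simp [hgs x y, hbs x y]
      · simpa using hr x
      · simp [hv]
    have hdisj : Disjoint (LinearMap.ker (g - r • b)) W := by
      rw [Submodule.disjoint_def]
      intro x hxL hxW
      by_contra hx
      have h1 := (hmem x).mp hxL x
      nlinarith [hW x hxW hx, hbp x hx]
    refine ⟨LinearMap.ker (g - r • b), le_antisymm ?_ ?_, fun h hh =>
      map_eq_of_forall_map_le H _ (fun k hk x hx => ?_) hh⟩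
    · have h1 := Submodule.finrank_add_eq_of_isCompl hc
      have h2 := Submodule.finrank_add_finrank_le_of_disjoint hdisj
      rw [finrank_span_singleton ht0] at h1
      omega
    · exact Submodule.one_le_finrank_iff.mpr fun h => hv0 (by simpa [h] using hvL)
    · rw [hmem] at hx ⊢
      intro y
      have hy : (k : V →L[ℝ] V) (((k⁻¹ : (V →L[ℝ] V)ˣ) : V →L[ℝ] V) y) = y := by
        change ((k : V →L[ℝ] V) * ((k⁻¹ : (V →L[ℝ] V)ˣ) : V →L[ℝ] V)) y = y
        simp
      rw [← hy, hgi k hk, hbi k hk, hx]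
  · rintro ⟨L, hL1, hL⟩
    obtain ⟨⟨t, htL⟩, ht0', hspan⟩ := finrank_eq_one_iff'.mp hL1
    have ht0 : t ≠ 0 := fun h => ht0' (by simp [h])
    have hbt := hbp t ht0
    have hflip : ∀ h ∈ H, ∃ c : ℝ, c * c = 1 ∧ (h : V →L[ℝ] V) t = c • t := by
      intro h hh
      have hm : (h : V →L[ℝ] V) t ∈ L := by
        have hm' := Submodule.mem_map_of_mem
          (f := ((h : V →L[ℝ] V) : V →ₗ[ℝ] V)) htL
        rwa [hL h hh] at hm'
      obtain ⟨c, hc⟩ := hspan ⟨_, hm⟩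
      have hc' : (h : V →L[ℝ] V) t = c • t := (congrArg Subtype.val hc).symm
      refine ⟨c, ?_, hc'⟩
      have := hbi h hh t t
      simp only [hc', map_smul, LinearMap.smul_apply, smul_eq_mul] at this
      exact mul_right_cancel₀ hbt.ne' (by linarith)
    have hpres : ∀ h ∈ H, ∃ c : ℝ, c * c = 1 ∧ ∀ x, b t ((h : V →L[ℝ] V) x) = c * b t x := by
      intro h hh
      obtain ⟨c, hc, hct⟩ := hflip h hh
      refine ⟨c, hc, fun x => ?_⟩
      have := hbi h hh t x
      rw [hct, map_smul, LinearMap.smul_apply, smul_eq_mul] at this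
      rw [← this, ← mul_assoc, hc, one_mul]
    let g : V →ₗ[ℝ] V →ₗ[ℝ] ℝ := b - (2 / b t t) • (LinearMap.mul ℝ ℝ).compl₁₂ (b t) (b t)
    have hg : ∀ x y, g x y = b x y - 2 / b t t * (b t x * b t y) := fun x y => by simp [g]
    refine ⟨g, fun x y => ?_, ⟨t, LinearMap.ker (b t), ?_, ?_, fun w hw => ?_, fun w hw hw0 => ?_⟩,
      fun h hh x y => ?_⟩
    · rw [hg, hg, hbs x y, mul_comm (b t x)]
    · refine (Module.Dual.isCompl_ker_of_disjoint_of_ne_bot (f := b t) ?_ ?_ ?_).symm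
      · rintro h
        simp [h] at hbt
      · rw [Submodule.disjoint_def]
        intro x hx hxt
        obtain ⟨a, rfl⟩ := Submodule.mem_span_singleton.mp hxt
        have : a = 0 := by simpa [hbt.ne'] using hx
        simp [this]
      · simpa using ht0
    · rw [hg]
      field_simp
      linarith
    · rw [LinearMap.mem_ker] at hw
      simp [hg, hw]
    · rw [LinearMap.mem_ker] at hw
      simpa [hg, hw] using hbp w hw0
    · obtain ⟨c, hc, hcx⟩ := hpres h hh
      rw [hg, hg, hbi h hh, hcx, hcx, mul_mul_mul_comm, hc, one_mul]
end

section
/- Let g be a Lorentzian symmetric bilinear form on a real vector space V of finite dimension n ≥ 2, and let H be a compact subgroup of GL(V) such that g(hx,hy) = g(x,y) for all h ∈ H and x,y ∈ V. Then there exists a vector t ∈ V with g(t,t) = −1 such that for every h ∈ H either ht = t or ht = −t; in particular the timelike line ℝt is invariant under H. -/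
/-- The orthogonal complement of a timelike vector of a Lorentzian form is positive definite. -/
theorem IsLorentzian.pos_of_orthogonal {V : Type*} [AddCommGroup V] [Module ℝ V]
    {g : V →ₗ[ℝ] V →ₗ[ℝ] ℝ} (hsymm : ∀ x y, g x y = g y x) (hg : IsLorentzian g)
    {x z : V} (hx : g x x < 0) (hxz : g x z = 0) (hz : z ≠ 0) : 0 < g z z := by
  obtain ⟨t, W, hc, -, -, hW⟩ := hg
  have hW' : ∀ w ∈ W, 0 ≤ g w w := fun w hw => by
    rcases eq_or_ne w 0 with rfl | h
    · simp
    · exact (hW w hw h).le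
  have decomp : ∀ v : V, ∃ a : ℝ, ∃ w ∈ W, v = a • t + w := fun v => by
    have hv : v ∈ Submodule.span ℝ ({t} : Set V) ⊔ W := hc.sup_eq_top ▸ Submodule.mem_top
    obtain ⟨y, hy, w, hw, rfl⟩ := Submodule.mem_sup.1 hv
    obtain ⟨a, rfl⟩ := Submodule.mem_span_singleton.1 hy
    exact ⟨a, w, hw, rfl⟩
  obtain ⟨a, w, hw, hxa⟩ := decomp x
  obtain ⟨b, u, hu, hzb⟩ := decomp z
  have ha : a ≠ 0 := by
    rintro rfl
    rw [zero_smul, zero_add] at hxa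
    exact absurd (hW' w hw) (hxa ▸ hx).not_ge
  rcases eq_or_ne b 0 with rfl | hb
  · rw [zero_smul, zero_add] at hzb
    exact hzb ▸ hW u hu (hzb ▸ hz)
  · have hmem : b • x - a • z ∈ W := by
      have : b • x - a • z = b • w - a • u := by rw [hxa, hzb]; module
      exact this ▸ W.sub_mem (W.smul_mem b hw) (W.smul_mem a hu)
    have h := hW' _ hmem
    simp only [map_sub, map_smul, LinearMap.sub_apply, LinearMap.smul_apply, smul_eq_mul,
      hsymm z x, hxz] at h
    have ha2 : 0 < a ^ 2 := by positivity
    have hb2 : 0 < b ^ 2 := by positivity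
    by_contra! hneg
    nlinarith [mul_neg_of_pos_of_neg hb2 hx, mul_nonneg ha2.le (neg_nonneg.2 hneg)]

/-- The sublevel sets of a continuous, positive function that is homogeneous of degree two are
bounded. -/
theorem isBounded_sublevel_of_homogeneous {V : Type*} [NormedAddCommGroup V]
    [NormedSpace ℝ V] [FiniteDimensional ℝ V] {e : V → ℝ} (he : Continuous e)
    (hsmul : ∀ (a : ℝ) x, e (a • x) = a ^ 2 * e x) (hpos : ∀ x, x ≠ 0 → 0 < e x) (C : ℝ) :
    Bornology.IsBounded {x | e x ≤ C} := by
  rcases subsingleton_or_nontrivial V with hV | hV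
  · exact (Set.toFinite _).isBounded
  have : ProperSpace V := FiniteDimensional.proper ℝ V
  obtain ⟨v, hv, hmin⟩ := (isCompact_sphere (0 : V) 1).exists_isMinOn
    (NormedSpace.sphere_nonempty.2 zero_le_one) he.continuousOn
  have hv0 : v ≠ 0 := by
    rintro rfl
    simp at hv
  have hm := hpos v hv0
  have hlow : ∀ x, ‖x‖ ^ 2 * e v ≤ e x := fun x => by
    rcases eq_or_ne x 0 with rfl | hx
    · have h : e 0 = 0 := by
        rw [← zero_smul ℝ (0 : V), hsmul, zero_pow two_ne_zero, zero_mul]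
      rw [h, norm_zero, zero_pow two_ne_zero, zero_mul]
    · have hn : ‖x‖ ≠ 0 := norm_ne_zero_iff.2 hx
      have hs : ‖x‖⁻¹ • x ∈ Metric.sphere (0 : V) 1 := by
        simp [norm_smul, hn]
      have h : e v ≤ e (‖x‖⁻¹ • x) := hmin hs
      calc ‖x‖ ^ 2 * e v ≤ ‖x‖ ^ 2 * e (‖x‖⁻¹ • x) := by gcongr
        _ = e x := by rw [hsmul]; field_simp
  refine isBounded_iff_forall_norm_le.2 ⟨√(C / e v), fun x hx => ?_⟩
  refine Real.le_sqrt_of_sq_le ((le_div_iff₀ hm).2 ((hlow x).trans hx))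

/-- If a compact subgroup `H ⊆ GL(V)` preserves a Lorentzian symmetric bilinear form `g`
on a real vector space of finite dimension `n ≥ 2`, then there is a vector `t` with
`g t t = -1` such that every `h ∈ H` satisfies `h t = t` or `h t = -t`; in particular the
timelike line `ℝ t` is `H`-invariant. -/
theorem stmt1 {n : ℕ} (hn : 2 ≤ n) {V : Type*} [NormedAddCommGroup V]
    [NormedSpace ℝ V] [FiniteDimensional ℝ V] (hdim : Module.finrank ℝ V = n)
    (g : V →ₗ[ℝ] V →ₗ[ℝ] ℝ) (hsymm : ∀ x y, g x y = g y x) (hg : IsLorentzian g)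
    (H : Subgroup (V →L[ℝ] V)ˣ) (hH : IsCompact (H : Set (V →L[ℝ] V)ˣ))
    (hinv : ∀ h ∈ H, ∀ x y : V, g ((h : V →L[ℝ] V) x) ((h : V →L[ℝ] V) y) = g x y) :
    ∃ t : V, g t t = -1 ∧
      ∀ h ∈ H, (h : V →L[ℝ] V) t = t ∨ (h : V →L[ℝ] V) t = -t := by
  have pos : ∀ {x z : V}, g x x < 0 → g x z = 0 → z ≠ 0 → 0 < g z z :=
    fun hx hxz hz => hg.pos_of_orthogonal hsymm hx hxz hz
  obtain ⟨t, -, -, ht, -⟩ := hg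
  have hq : Continuous fun x : V => g x x := by
    let G : V →L[ℝ] V →L[ℝ] ℝ :=
      LinearMap.toContinuousLinearMap (LinearMap.toContinuousLinearMap.toLinearMap ∘ₗ g)
    exact G.continuous.clm_apply continuous_id
  have hgt : Continuous (g t) := (g t).continuous_of_finiteDimensional
  have htH : ∀ h ∈ H, Continuous fun x : V => |g t ((h : V →L[ℝ] V) x)| :=
    fun h _ => (hgt.comp (h : V →L[ℝ] V).continuous).abs
  -- We maximize `-g x x` on the compact set `K`, which is symmetric and `H`-invariant.
  let K : Set V := {x | g x x ≤ 0 ∧ ∀ h ∈ H, |g t ((h : V →L[ℝ] V) x)| ≤ 1}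
  have hKclosed : IsClosed K := by
    have : K = {x | g x x ≤ 0} ∩ ⋂ h ∈ H, {x : V | |g t ((h : V →L[ℝ] V) x)| ≤ 1} := by
      ext x
      simp [K]
    rw [this]
    exact (isClosed_le hq continuous_const).inter
      (isClosed_biInter fun h hh => isClosed_le (htH h hh) continuous_const)
  have hKbdd : Bornology.IsBounded K := by
    refine (isBounded_sublevel_of_homogeneous (e := fun x => g x x * (-g t t) + 2 * g t x ^ 2)
      ((hq.mul continuous_const).add (continuous_const.mul (hgt.pow 2))) (fun a x => ?_)
      (fun x hx => ?_) 2).subset fun x hx => ?_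
    · simp only [map_smul, LinearMap.smul_apply, smul_eq_mul]
      ring
    · rcases eq_or_ne (g t x) 0 with h0 | h0
      · have := mul_pos (pos ht h0 hx) (neg_pos.2 ht)
        simpa [h0] using this
      · set z := g t t • x - g t x • t with hz
        have hzt : g t z = 0 := by
          simp only [hz, map_sub, map_smul, smul_eq_mul]
          ring
        have hzz : 0 ≤ g z z := by
          rcases eq_or_ne z 0 with h | h
          · simp [h]
          · exact (pos ht hzt h).le
        have hzz' : g z z = g t t * (g t t * g x x - g t x ^ 2) := by
          simp only [hz, map_sub, map_smul, LinearMap.sub_apply, LinearMap.smul_apply,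
            smul_eq_mul, hsymm x t]
          ring
        have : 0 < g t x ^ 2 := by positivity
        have : g t t * g x x - g t x ^ 2 ≤ 0 := by
          by_contra! hlt
          exact absurd hzz (hzz' ▸ mul_neg_of_neg_of_pos ht hlt).not_ge
        linarith
    · have h1 : |g t x| ≤ 1 := by simpa using hx.2 1 H.one_mem
      have h2 : g t x ^ 2 ≤ 1 := (sq_le_one_iff_abs_le_one _).2 h1
      have h3 := mul_nonneg_of_nonpos_of_nonpos hx.1 ht.le
      simp only [Set.mem_ofPred_eq]
      linarith
  have : ProperSpace V := FiniteDimensional.proper ℝ V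
  obtain ⟨B, hB⟩ := hH.exists_bound_of_continuousOn
    (f := fun h : (V →L[ℝ] V)ˣ => g t ((h : V →L[ℝ] V) t))
    (hgt.comp (Units.continuous_val.clm_apply continuous_const)).continuousOn
  have hBpos : 0 < max B 1 := lt_max_of_lt_right one_pos
  have hx₀ : (max B 1)⁻¹ • t ∈ K := by
    refine ⟨?_, fun h hh => ?_⟩
    · simp only [map_smul, LinearMap.smul_apply, smul_eq_mul]
      have := inv_pos.2 hBpos
      nlinarith [mul_pos this this]
    · have hb : |g t ((h : V →L[ℝ] V) t)| ≤ max B 1 := (hB h hh).trans (le_max_left _ _)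
      simp only [map_smul, smul_eq_mul, abs_mul, abs_inv, abs_of_pos hBpos]
      exact inv_mul_le_one_of_le₀ hb hBpos.le
  obtain ⟨x, hxK, hmin⟩ :=
    (Metric.isCompact_of_isClosed_isBounded hKclosed hKbdd).exists_isMinOn ⟨_, hx₀⟩ hq.continuousOn
  have hmin' : ∀ y ∈ K, g x x ≤ g y y := fun y hy => hmin hy
  have hxneg : g x x < 0 := by
    refine (hmin' _ hx₀).trans_lt ?_
    simp only [map_smul, LinearMap.smul_apply, smul_eq_mul]
    have := inv_pos.2 hBpos
    nlinarith [mul_pos this this, mul_neg_of_pos_of_neg (mul_pos this this) ht]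
  have hunique : ∀ y ∈ K, g y y = g x x → g x y ≤ 0 → y = x := fun y hy hyx hxy => by
    by_contra hne
    have hpos := pos (x := x + y) (z := x - y)
      (by simp only [map_add, LinearMap.add_apply, hsymm y x]; linarith)
      (by simp only [map_add, map_sub, LinearMap.add_apply, hsymm y x]; linarith)
      (sub_ne_zero.2 (Ne.symm hne))
    simp only [map_sub, LinearMap.sub_apply, hsymm y x] at hpos
    have hmid := hmin' ((1 / 2 : ℝ) • (x + y)) ⟨by
      simp only [map_smul, map_add, LinearMap.add_apply, LinearMap.smul_apply, smul_eq_mul,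
        hsymm y x]
      linarith, fun h hh => by
      have h1 := abs_le.1 (hxK.2 h hh)
      have h2 := abs_le.1 (hy.2 h hh)
      simp only [map_smul, map_add, smul_eq_mul]
      exact abs_le.2 ⟨by linarith, by linarith⟩⟩
    simp only [map_smul, map_add, LinearMap.add_apply, LinearMap.smul_apply, smul_eq_mul,
      hsymm y x] at hmid
    linarith
  have hfix : ∀ h ∈ H, (h : V →L[ℝ] V) x = x ∨ (h : V →L[ℝ] V) x = -x := fun h hh => by
    have hgh := hinv h hh x x
    have hK : (h : V →L[ℝ] V) x ∈ K :=
      ⟨hgh ▸ hxK.1, fun k hk => by simpa using hxK.2 (k * h) (H.mul_mem hk hh)⟩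
    rcases le_total (g x ((h : V →L[ℝ] V) x)) 0 with hle | hle
    · exact .inl (hunique _ hK hgh hle)
    · refine .inr (neg_eq_iff_eq_neg.1 (hunique _ ⟨?_, fun k hk => ?_⟩ ?_ ?_))
      · simpa using hK.1
      · simpa using hK.2 k hk
      · simpa using hgh
      · simpa using hle
  refine ⟨(√(-g x x))⁻¹ • x, ?_, fun h hh => ?_⟩
  · simp only [map_smul, LinearMap.smul_apply, smul_eq_mul]
    have hs := Real.sq_sqrt (neg_pos.2 hxneg).le
    have hs0 : √(-g x x) ≠ 0 := (Real.sqrt_pos.2 (neg_pos.2 hxneg)).ne'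
    field_simp
    linarith
  · rcases hfix h hh with h1 | h1
    · exact .inl (by rw [map_smul, h1])
    · exact .inr (by rw [map_smul, h1, smul_neg])
end

section
/- Let g be a Lorentzian symmetric bilinear form on a real vector space V of finite dimension n ≥ 2, and let H be a compact connected subgroup of GL(V) such that g(hx,hy) = g(x,y) for all h ∈ H and x,y ∈ V. Then there exists a vector t ∈ V with g(t,t) = −1 and ht = t for every h ∈ H. -/
/-- A nonspacelike vector orthogonal to a timelike vector vanishes. -/
theorem IsLorentzian.eq_zero_of_orthogonal {V : Type*} [AddCommGroup V] [Module ℝ V]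
    {g : V →ₗ[ℝ] V →ₗ[ℝ] ℝ} (hsymm : ∀ x y, g x y = g y x) (hg : IsLorentzian g)
    {x y : V} (hx : g x x < 0) (hy : g y y ≤ 0) (hxy : g x y = 0) : y = 0 := by
  obtain ⟨t, W, hc, -, -, hW⟩ := hg
  have dec : ∀ v : V, ∃ a : ℝ, ∃ w ∈ W, a • t + w = v := by
    intro v
    have hv : v ∈ Submodule.span ℝ ({t} : Set V) ⊔ W := by
      rw [hc.sup_eq_top]; trivial
    obtain ⟨p, hp, w, hw, rfl⟩ := Submodule.mem_sup.1 hv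
    obtain ⟨a, rfl⟩ := Submodule.mem_span_singleton.1 hp
    exact ⟨a, w, hw, rfl⟩
  have hW' : ∀ w ∈ W, g w w ≤ 0 → w = 0 := fun w hw h => by
    by_contra h0
    exact absurd (hW w hw h0) (not_lt.2 h)
  obtain ⟨a, w, hw, hxe⟩ := dec x
  obtain ⟨b, w', hw', hye⟩ := dec y
  have hz : b • x - a • y ∈ W := by
    have : b • x - a • y = b • w - a • w' := by
      rw [← hxe, ← hye]; module
    rw [this]
    exact W.sub_mem (W.smul_mem _ hw) (W.smul_mem _ hw')
  have hgz : g (b • x - a • y) (b • x - a • y) = b ^ 2 * g x x + a ^ 2 * g y y := by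
    simp only [map_sub, map_smul, LinearMap.sub_apply, LinearMap.smul_apply, smul_eq_mul,
      hsymm y x, hxy]
    ring
  have h1 : b ^ 2 * g x x ≤ 0 := mul_nonpos_of_nonneg_of_nonpos (sq_nonneg b) hx.le
  have h2 : a ^ 2 * g y y ≤ 0 := mul_nonpos_of_nonneg_of_nonpos (sq_nonneg a) hy
  have hz0 := hW' _ hz (by rw [hgz]; linarith)
  have h3 : b ^ 2 * g x x + a ^ 2 * g y y = 0 := by rw [← hgz, hz0]; simp
  have hb : b = 0 := by
    have h4 : b ^ 2 * g x x = 0 := by linarith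
    simpa [hx.ne] using h4
  have hyW : y ∈ W := by
    rw [← hye, hb, zero_smul, zero_add]; exact hw'
  exact hW' y hyW hy

/-- Two timelike vectors in the same time cone have negative product. -/
theorem IsLorentzian.apply_neg_of_same_cone {V : Type*} [AddCommGroup V] [Module ℝ V]
    {g : V →ₗ[ℝ] V →ₗ[ℝ] ℝ} (hsymm : ∀ x y, g x y = g y x) (hg : IsLorentzian g)
    {t u v : V} (ht : g t t < 0) (hu : g u u < 0) (hv : g v v < 0)
    (htu : g t u < 0) (htv : g t v < 0) : g u v < 0 := by
  by_contra! huv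
  have horth : g t (g t v • u - g t u • v) = 0 := by
    simp only [map_sub, map_smul, smul_eq_mul]
    ring
  have hgy : g (g t v • u - g t u • v) (g t v • u - g t u • v) =
      g t v ^ 2 * g u u + g t u ^ 2 * g v v - 2 * (g t u * g t v) * g u v := by
    simp only [map_sub, map_smul, LinearMap.sub_apply, LinearMap.smul_apply, smul_eq_mul,
      hsymm v u]
    ring
  have h1 : g t v ^ 2 * g u u < 0 := mul_neg_of_pos_of_neg (sq_pos_of_neg htv) hu
  have h2 : g t u ^ 2 * g v v < 0 := mul_neg_of_pos_of_neg (sq_pos_of_neg htu) hv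
  have h3 : 0 ≤ 2 * (g t u * g t v) * g u v :=
    mul_nonneg (mul_nonneg zero_le_two (mul_pos_of_neg_of_neg htu htv).le) huv
  have h0 := hg.eq_zero_of_orthogonal hsymm ht (by rw [hgy]; linarith) horth
  rw [h0, map_zero] at hgy
  linarith

/-- Timelike vectors of equal length in the same time cone coincide as soon as their difference
is not spacelike. -/
theorem IsLorentzian.eq_of_same_cone {V : Type*} [AddCommGroup V] [Module ℝ V]
    {g : V →ₗ[ℝ] V →ₗ[ℝ] ℝ} (hsymm : ∀ x y, g x y = g y x) (hg : IsLorentzian g)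
    {t u v : V} (ht : g t t < 0) (hu : g u u < 0) (huv : g v v = g u u)
    (htu : g t u < 0) (htv : g t v < 0) (hle : g u u ≤ g u v) : v = u := by
  have hneg := hg.apply_neg_of_same_cone hsymm ht hu (huv ▸ hu) htu htv
  refine sub_eq_zero.1 (hg.eq_zero_of_orthogonal hsymm (x := u + v) ?_ ?_ ?_) <;>
    simp only [map_sub, map_add, LinearMap.sub_apply, LinearMap.add_apply, hsymm v u, huv] <;>
    linarith


/-- If a compact **connected** subgroup `H ⊆ GL(V)` preserves a Lorentzian symmetric
bilinear form `g` on a real vector space of finite dimension `n ≥ 2`, then there is a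
vector `t` with `g t t = -1` fixed by every element of `H`. -/
theorem stmt2 {n : ℕ} (hn : 2 ≤ n) {V : Type*} [NormedAddCommGroup V]
    [NormedSpace ℝ V] [FiniteDimensional ℝ V] (hdim : Module.finrank ℝ V = n)
    (g : V →ₗ[ℝ] V →ₗ[ℝ] ℝ) (hsymm : ∀ x y, g x y = g y x) (hg : IsLorentzian g)
    (H : Subgroup (V →L[ℝ] V)ˣ) (hH : IsCompact (H : Set (V →L[ℝ] V)ˣ))
    (hconn : IsConnected (H : Set (V →L[ℝ] V)ˣ))
    (hinv : ∀ h ∈ H, ∀ x y : V, g ((h : V →L[ℝ] V) x) ((h : V →L[ℝ] V) y) = g x y) :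
    ∃ t : V, g t t = -1 ∧ ∀ h ∈ H, (h : V →L[ℝ] V) t = t := by
  obtain ⟨t₀, ht₀⟩ : ∃ t, g t t < 0 := by
    obtain ⟨t, _, _, ht, _⟩ := hg
    exact ⟨t, ht⟩
  have hcont : Continuous fun v : V => g v v := by
    have : Continuous fun v : V => g.toContinuousBilinearMap v v := by fun_prop
    exact this
  have hcont₀ : Continuous (g t₀) := (g t₀).continuous_of_finiteDimensional
  have horb : Continuous fun h : (V →L[ℝ] V)ˣ => (h : V →L[ℝ] V) t₀ :=
    Units.continuous_val.clm_apply continuous_const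
  have hcone : ∀ h ∈ H, g t₀ ((h : V →L[ℝ] V) t₀) < 0 := by
    intro h hh
    by_contra! hpos
    obtain ⟨k, hk, hk0⟩ := hconn.isPreconnected.intermediate_value H.one_mem hh
      (hcont₀.comp horb).continuousOn (show (0 : ℝ) ∈ Set.Icc _ _ from
        ⟨by simpa using ht₀.le, hpos⟩)
    have hkk := hinv k hk t₀ t₀
    have h0 := hg.eq_zero_of_orthogonal hsymm ht₀ (hkk.trans_le ht₀.le) hk0
    rw [h0, map_zero] at hkk
    exact ht₀.ne' hkk
  set S : Set V := (fun h : (V →L[ℝ] V)ˣ => (h : V →L[ℝ] V) t₀) '' H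
  set K : Set V := closure (convexHull ℝ S)
  have hKcompact : IsCompact K :=
    (isBounded_convexHull.2 (hH.image horb).isBounded).isCompact_closure
  have hKconvex : Convex ℝ K := (convex_convexHull ℝ S).closure
  have hKcone : ∀ v ∈ K, g v v < 0 → g t₀ v < 0 := by
    have hsub : K ⊆ {v | g t₀ v ≤ 0} := by
      refine closure_minimal (convexHull_min ?_ (convex_halfSpace_le (g t₀).isLinear 0))
        (isClosed_le hcont₀ continuous_const)
      rintro _ ⟨h, hh, rfl⟩
      exact (hcone h hh).le
    refine fun v hv hvv => (hsub hv).lt_of_ne fun h0 => ?_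
    rw [hg.eq_zero_of_orthogonal hsymm ht₀ hvv.le h0, map_zero] at hvv
    exact lt_irrefl _ hvv
  have ht₀K : t₀ ∈ K := subset_closure (subset_convexHull _ _ ⟨1, H.one_mem, by simp⟩)
  have hKinv : ∀ h ∈ H, ∀ v ∈ K, (h : V →L[ℝ] V) v ∈ K := by
    intro h hh v hv
    refine map_mem_closure (h : V →L[ℝ] V).continuous hv fun w hw => ?_
    have hmem : (h : V →L[ℝ] V) w ∈ ((h : V →L[ℝ] V) : V →ₗ[ℝ] V) '' convexHull ℝ S :=
      ⟨w, hw, rfl⟩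
    rw [LinearMap.image_convexHull] at hmem
    refine convexHull_mono ?_ hmem
    rintro _ ⟨_, ⟨k, hk, rfl⟩, rfl⟩
    exact ⟨h * k, H.mul_mem hh hk, by simp⟩
  obtain ⟨u, huK, hmin⟩ := hKcompact.exists_isMinOn ⟨t₀, ht₀K⟩ hcont.continuousOn
  have hu : g u u < 0 := (hmin ht₀K).trans_lt ht₀
  have hfix : ∀ h ∈ H, (h : V →L[ℝ] V) u = u := by
    intro h hh
    have hvK := hKinv h hh u huK
    have hvv := hinv h hh u u
    refine hg.eq_of_same_cone hsymm ht₀ hu hvv (hKcone u huK hu)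
      (hKcone _ hvK (hvv ▸ hu)) ?_
    have hmid := hKconvex huK hvK (by norm_num : (0 : ℝ) ≤ 1 / 2)
      (by norm_num : (0 : ℝ) ≤ 1 / 2) (by norm_num)
    have hle : g u u ≤ _ := hmin hmid
    simp only [map_add, map_smul, LinearMap.add_apply, LinearMap.smul_apply, smul_eq_mul,
      hsymm _ u, hvv] at hle
    linarith
  refine ⟨(√(-g u u))⁻¹ • u, ?_, fun h hh => by rw [map_smul, hfix h hh]⟩
  have hs : √(-g u u) ^ 2 = -g u u := Real.sq_sqrt (by linarith)
  have hs0 : √(-g u u) ≠ 0 := (Real.sqrt_pos.2 (by linarith)).ne'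
  simp only [map_smul, LinearMap.smul_apply, smul_eq_mul]
  field_simp
  linarith
end

section
/- Let p, q ≥ 1 be integers with p + q ≥ 3 and set n = p + q. Consider block-diagonal matrices A ⊕ B ∈ SO(n) with A ∈ SO(p) and B ∈ SO(q). Then the set of real symmetric n × n matrices X with trace zero satisfying (A ⊕ B) X (A ⊕ B)ᵀ = X for all A ∈ SO(p) and B ∈ SO(q) is exactly the one-dimensional subspace ℝ · b, where b = diag(q·I_p, −p·I_q). -/
open Matrix

section QuarterTurn

variable {m l : Type*} [Fintype m] [DecidableEq m]

/-- The rotation by a right angle in the coordinate plane spanned by `i` and `j`, written as a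
signed permutation matrix. -/
noncomputable def quarterTurn (i j : m) : Matrix m m ℝ :=
  Matrix.diagonal (Function.update 1 i (-1)) * (Equiv.swap i j).permMatrix ℝ

theorem quarterTurn_mul_apply (i j : m) (M : Matrix m l ℝ) (a : m) (b : l) :
    (quarterTurn i j * M) a b =
      (Function.update 1 i (-1) : m → ℝ) a * M (Equiv.swap i j a) b := by
  rw [quarterTurn, Matrix.mul_assoc, Matrix.diagonal_mul, Equiv.Perm.permMatrix,
    PEquiv.toMatrix_toPEquiv_mul]
  rfl

theorem mul_quarterTurn_transpose_apply (i j : m) (M : Matrix l m ℝ) (a : l) (b : m) :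
    (M * (quarterTurn i j)ᵀ) a b =
      (Function.update 1 i (-1) : m → ℝ) b * M a (Equiv.swap i j b) := by
  rw [← Matrix.transpose_apply (M * _), Matrix.transpose_mul, Matrix.transpose_transpose,
    quarterTurn_mul_apply, Matrix.transpose_apply]

theorem quarterTurn_transpose_mul_self (i j : m) :
    (quarterTurn i j)ᵀ * quarterTurn i j = 1 := by
  rw [mul_eq_one_comm]
  ext a b
  rw [quarterTurn_mul_apply, ← Matrix.one_mul (quarterTurn i j)ᵀ,
    mul_quarterTurn_transpose_apply, Matrix.one_apply, Matrix.one_apply]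
  rcases eq_or_ne a b with rfl | h
  · rcases eq_or_ne a i with rfl | h' <;> simp [*]
  · simp [h]

theorem det_quarterTurn {i j : m} (hij : i ≠ j) : (quarterTurn i j).det = 1 := by
  rw [quarterTurn, Matrix.det_mul, Matrix.det_diagonal, Matrix.det_permutation,
    Equiv.Perm.sign_swap hij, Finset.prod_update_of_mem (Finset.mem_univ i)]
  simp

/-- A symmetric matrix invariant under conjugation by the special orthogonal group is scalar. -/
theorem exists_eq_diagonal_of_conj_invariant [Nonempty m] {S : Matrix m m ℝ} (hS : Sᵀ = S)
    (h : ∀ A : Matrix m m ℝ, Aᵀ * A = 1 → A.det = 1 → A * S * Aᵀ = S) :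
    ∃ s : ℝ, S = Matrix.diagonal fun _ => s := by
  have key {i j : m} (hij : i ≠ j) (a b : m) :
      (Function.update 1 i (-1) : m → ℝ) b *
        ((Function.update 1 i (-1) : m → ℝ) a * S (Equiv.swap i j a) (Equiv.swap i j b)) = S a b := by
    rw [← quarterTurn_mul_apply, ← mul_quarterTurn_transpose_apply,
      h _ (quarterTurn_transpose_mul_self i j) (det_quarterTurn hij)]
  obtain ⟨k⟩ := ‹Nonempty m›
  refine ⟨S k k, ?_⟩
  ext i j
  rcases eq_or_ne i j with rfl | hij
  · rcases eq_or_ne i k with rfl | hik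
    · simp
    · simpa using (key hik i i).symm
  · have h₁ := key hij i j
    have h₂ : S j i = S i j := congrFun (congrFun hS i) j
    simp [hij.symm] at h₁
    simp only [Matrix.diagonal_apply_ne _ hij]
    linarith

/-- A matrix invariant under left multiplication by the special orthogonal group of rank at
least two vanishes. -/
theorem eq_zero_of_mul_invariant [Nontrivial m] {C : Matrix m l ℝ}
    (h : ∀ A : Matrix m m ℝ, Aᵀ * A = 1 → A.det = 1 → A * C = C) : C = 0 := by
  ext i b
  obtain ⟨j, hji⟩ := exists_ne i
  have key (a : m) : (Function.update 1 i (-1) : m → ℝ) a * C (Equiv.swap i j a) b = C a b := by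
    rw [← quarterTurn_mul_apply, h _ (quarterTurn_transpose_mul_self i j)
      (det_quarterTurn hji.symm)]
  have h₁ := key i
  have h₂ := key j
  simp [hji] at h₁ h₂
  simp only [Matrix.zero_apply]
  linarith

end QuarterTurn

/-- For `p, q ≥ 1` with `p + q ≥ 3`, the real symmetric traceless `(p+q) × (p+q)` matrices
invariant under conjugation by all block-diagonal matrices `A ⊕ B` with `A ∈ SO(p)`,
`B ∈ SO(q)` form exactly the line `ℝ · b`, where `b = diag(q·I_p, -p·I_q)`. -/
theorem stmt9 (p q : ℕ) (hp : 1 ≤ p) (hq : 1 ≤ q) (hpq : 3 ≤ p + q) :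
    {X : Matrix (Fin p ⊕ Fin q) (Fin p ⊕ Fin q) ℝ |
        Xᵀ = X ∧ X.trace = 0 ∧
        ∀ (A : Matrix (Fin p) (Fin p) ℝ) (B : Matrix (Fin q) (Fin q) ℝ),
          Aᵀ * A = 1 → A.det = 1 → Bᵀ * B = 1 → B.det = 1 →
          Matrix.fromBlocks A 0 0 B * X * (Matrix.fromBlocks A 0 0 B)ᵀ = X}
      = {X | ∃ c : ℝ,
          X = c • Matrix.diagonal (Sum.elim (fun _ => (q : ℝ)) fun _ => -(p : ℝ))} := by
  ext X
  constructor
  · rintro ⟨hsymm, htr, hinv⟩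
    obtain ⟨P, C, D, Q, rfl⟩ : ∃ P C D Q, X = Matrix.fromBlocks P C D Q :=
      ⟨_, _, _, _, (Matrix.fromBlocks_toBlocks X).symm⟩
    simp only [Matrix.fromBlocks_transpose, Matrix.fromBlocks_multiply, Matrix.fromBlocks_inj,
      Matrix.transpose_zero, Matrix.zero_mul, Matrix.mul_zero, add_zero, zero_add] at hsymm hinv
    obtain ⟨hP, hDC, -, hQ⟩ := hsymm
    have : Nonempty (Fin p) := ⟨⟨0, hp⟩⟩
    have : Nonempty (Fin q) := ⟨⟨0, hq⟩⟩
    obtain ⟨s, rfl⟩ := exists_eq_diagonal_of_conj_invariant hP fun A hA hA' =>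
      (hinv A 1 hA hA' (by simp) (by simp)).1
    obtain ⟨t, rfl⟩ := exists_eq_diagonal_of_conj_invariant hQ fun B hB hB' =>
      (hinv 1 B (by simp) (by simp) hB hB').2.2.2
    have hD : D = 0 := by
      rcases le_or_gt 2 p with h2 | h2
      · have : Nontrivial (Fin p) := Fin.nontrivial_iff_two_le.2 h2
        rw [← Matrix.transpose_eq_zero, hDC]
        exact eq_zero_of_mul_invariant fun A hA hA' => by
          simpa using (hinv A 1 hA hA' (by simp) (by simp)).2.1
      · have : Nontrivial (Fin q) := Fin.nontrivial_iff_two_le.2 (by omega)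
        exact eq_zero_of_mul_invariant fun B hB hB' => by
          simpa using (hinv 1 B (by simp) (by simp) hB hB').2.2.1
    subst hD
    have hC : C = 0 := by simpa using hDC.symm
    subst hC
    have hq0 : (q : ℝ) ≠ 0 := by positivity
    rw [Matrix.fromBlocks_diagonal] at htr ⊢
    simp only [Matrix.trace_diagonal, Fintype.sum_sum_type, Sum.elim_inl, Sum.elim_inr,
      Finset.sum_const, Finset.card_univ, Fintype.card_fin, nsmul_eq_mul] at htr
    refine ⟨s / q, ?_⟩
    rw [← Matrix.diagonal_smul]
    congr 1
    ext (i | i)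
    · simp [hq0]
    · simp only [Sum.elim_inr, Pi.smul_apply, smul_eq_mul]
      field_simp
      linarith
  · rintro ⟨c, rfl⟩
    refine ⟨by simp, ?_, fun A B hA _ hB _ => ?_⟩
    · simp [Matrix.trace_smul, Matrix.trace_diagonal]
      ring_nf
      simp
    · rw [mul_eq_one_comm] at hA hB
      have hb : Matrix.diagonal (Sum.elim (fun _ => (q : ℝ)) fun _ => -(p : ℝ)) =
          Matrix.fromBlocks ((q : ℝ) • (1 : Matrix (Fin p) (Fin p) ℝ)) 0 0
            (-(p : ℝ) • (1 : Matrix (Fin q) (Fin q) ℝ)) := by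
        rw [Matrix.smul_one_eq_diagonal, Matrix.smul_one_eq_diagonal, Matrix.fromBlocks_diagonal]
      rw [hb, Matrix.mul_smul, Matrix.smul_mul]
      simp [Matrix.fromBlocks_transpose, Matrix.fromBlocks_multiply, hA, hB]
end

section
/- Let n ≥ 2 and let S be a nonzero real symmetric n × n matrix with trace zero. Then there exists a nonzero real symmetric n × n matrix T with trace zero and exactly two distinct eigenvalues — i.e., there exist real numbers μ₁ ≠ μ₂ with (T − μ₁ I)(T − μ₂ I) = 0 and T ≠ μ₁ I, T ≠ μ₂ I — such that every orthogonal matrix A (AᵀA = I) with A S Aᵀ = S also satisfies A T Aᵀ = T. -/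
open Matrix

/-- A self-adjoint real matrix with at most one spectral value is scalar. -/
theorem Matrix.exists_eq_smul_one_of_subsingleton_spectrum {ι : Type*} [Fintype ι]
    [DecidableEq ι] {S : Matrix ι ι ℝ} (hS : IsSelfAdjoint S)
    (h : (spectrum ℝ S).Subsingleton) : ∃ c : ℝ, S = c • 1 := by
  obtain h0 | ⟨c, hc⟩ := h.eq_empty_or_singleton
  · refine ⟨0, ?_⟩
    rw [← cfc_id ℝ S, cfc_congr (g := fun _ => (0 : ℝ)) (by simp [h0, Set.EqOn])]
    simp
  · refine ⟨c, ?_⟩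
    conv_lhs => rw [← cfc_id ℝ S, cfc_congr (g := fun _ => c) (by simp [hc, Set.EqOn])]
    rw [cfc_const c S, Algebra.algebraMap_eq_smul_one]

/-- A non-scalar self-adjoint real matrix has a nontrivial spectral projection. -/
theorem Matrix.exists_nontrivial_spectral_projection {ι : Type*} [Fintype ι]
    [DecidableEq ι] {S : Matrix ι ι ℝ} (hS : IsSelfAdjoint S)
    (h : ∀ c : ℝ, S ≠ c • 1) :
    ∃ P : Matrix ι ι ℝ, IsSelfAdjoint P ∧ P * P = P ∧ P ≠ 0 ∧ P ≠ 1 ∧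
      ∀ A : Matrix ι ι ℝ, Commute S A → Commute P A := by
  have hnt : (spectrum ℝ S).Nontrivial := by
    rw [← Set.not_subsingleton_iff]
    intro hs
    obtain ⟨c, hc⟩ := Matrix.exists_eq_smul_one_of_subsingleton_spectrum hS hs
    exact h c hc
  obtain ⟨a, ha, b, hb, hab⟩ := hnt
  have : Nonempty ι := by
    by_contra hι
    rw [not_nonempty_iff] at hι
    exact h 0 (Subsingleton.elim _ _)
  let f : ℝ → ℝ := fun x => if x = a then 1 else 0
  have hf : ContinuousOn f (spectrum ℝ S) :=
    (Matrix.finite_real_spectrum (A := S)).continuousOn f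
  have hspec := cfc_map_spectrum f S hS hf
  refine ⟨cfc f S, cfc_predicate f S, ?_, ?_, ?_, fun A hA => ?_⟩
  · rw [← cfc_mul f f S hf hf]
    congr 1
    ext x
    simp [f]
  · intro h0
    have : f a ∈ spectrum ℝ (cfc f S) := hspec ▸ Set.mem_image_of_mem f ha
    rw [h0, spectrum.zero_eq] at this
    simp [f] at this
  · intro h1
    have : f b ∈ spectrum ℝ (cfc f S) := hspec ▸ Set.mem_image_of_mem f hb
    rw [h1, spectrum.one_eq] at this
    simp [f, hab.symm] at this
  · exact hS.commute_cfc hA f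

/-- For every nonzero traceless real symmetric `n × n` matrix `S` (`n ≥ 2`) there is a
nonzero traceless symmetric matrix `T` with exactly two distinct eigenvalues (i.e. there
are `μ₁ ≠ μ₂` with `(T - μ₁ I)(T - μ₂ I) = 0`, `T ≠ μ₁ I`, `T ≠ μ₂ I`) such that every
orthogonal matrix `A` stabilizing `S` by conjugation also stabilizes `T`. -/
theorem stmt10 (n : ℕ) (hn : 2 ≤ n) (S : Matrix (Fin n) (Fin n) ℝ)
    (hSsymm : Sᵀ = S) (hStr : S.trace = 0) (hS0 : S ≠ 0) :
    ∃ T : Matrix (Fin n) (Fin n) ℝ, T ≠ 0 ∧ Tᵀ = T ∧ T.trace = 0 ∧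
      (∃ μ₁ μ₂ : ℝ, μ₁ ≠ μ₂ ∧
        (T - μ₁ • (1 : Matrix (Fin n) (Fin n) ℝ)) * (T - μ₂ • 1) = 0 ∧
        T ≠ μ₁ • 1 ∧ T ≠ μ₂ • 1) ∧
      ∀ A : Matrix (Fin n) (Fin n) ℝ, Aᵀ * A = 1 → A * S * Aᵀ = S → A * T * Aᵀ = T := by
  have hn0 : (n : ℝ) ≠ 0 := by
    have : n ≠ 0 := by omega
    exact_mod_cast this
  have hS : IsSelfAdjoint S := by
    rw [IsSelfAdjoint, star_eq_conjTranspose, conjTranspose_eq_transpose_of_trivial, hSsymm]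
  obtain ⟨P, hP, hPP, hP0, hP1, hcomm⟩ :=
    Matrix.exists_nontrivial_spectral_projection hS (by
      rintro c rfl
      simp [trace_smul, hn0] at hStr
      exact hS0 (by simp [hStr]))
  have hPt : Pᵀ = P := by
    rwa [IsSelfAdjoint, star_eq_conjTranspose, conjTranspose_eq_transpose_of_trivial] at hP
  set t : ℝ := P.trace / n with ht
  have h₁ : P - t • 1 - (1 - t) • 1 = P - 1 := by module
  have h₂ : P - t • 1 - (-t) • 1 = P := by module
  refine ⟨P - t • 1, fun h0 => ?_, ?_, ?_, ⟨1 - t, -t, ?_, ?_, fun h => ?_, fun h => ?_⟩,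
    fun A hA hAS => ?_⟩
  · have hPt1 : P = t • 1 := sub_eq_zero.mp h0
    have hP' : (1 - t) • P = 0 := by
      have : P * P = t • P := by
        nth_rewrite 1 [hPt1]
        simp
      rw [sub_smul, one_smul, ← this, hPP, sub_self]
    rcases smul_eq_zero.mp hP' with h | h
    · rw [← sub_eq_zero.mp h, one_smul] at hPt1
      exact hP1 hPt1
    · exact hP0 h
  · simp [hPt]
  · simp [trace_sub, trace_smul, ht, hn0]
  · intro h
    linarith
  · rw [h₁, h₂, sub_mul, hPP, one_mul, sub_self]
  · rw [← sub_eq_zero, h₁, sub_eq_zero] at h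
    exact hP1 h
  · rw [← sub_eq_zero, h₂] at h
    exact hP0 h
  · have hA' : A * Aᵀ = 1 := mul_eq_one_comm.mp hA
    have hSA : Commute S A := by
      rw [Commute, SemiconjBy]
      nth_rewrite 1 [← hAS]
      rw [mul_assoc, hA, mul_one]
    rw [mul_sub, sub_mul, ← (hcomm A hSA).eq, mul_assoc P, hA', mul_one]
    simp [hA']
end
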